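/- For every k ≥ 2, the set C_k ⊆ ℝ^k × Skew_k ≅ ℝ^{k(k+1)/2} has Hausdorff dimension k(k+1)/2 − 2; i.e., its codimension is 2. -/

import Mathlib

open Matrix
open scoped ENNReal

attribute [local instance] Matrix.normedAddCommGroup

noncomputable section

/-- The set of cut points `C_k`. -/
def Cset (k : ℕ) : Set ((Fin k → ℝ) × Matrix (Fin k) (Fin k) ℝ) :=
  {p | p.2ᵀ = -p.2 ∧ p.2 ≠ 0 ∧ ∃ M : Matrix (Fin k) (Fin k) ℝ,
    M * Mᵀ = 1 ∧ M ≠ 1 ∧ M.mulVec p.1 = p.1 ∧ M * p.2 * Mᵀ = p.2 ∧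
    ∀ v : Fin k → ℝ, p.2.mulVec v = 0 → M.mulVec v = v}

attribute [local instance] Matrix.normedSpace

/-- The standard generator of `Skew_2`. -/
def rotGen : Matrix (Fin 2) (Fin 2) ℝ := !![0, 1; -1, 0]

lemma rotGen_transpose : rotGenᵀ = -rotGen := by
  ext i j
  fin_cases i <;> fin_cases j <;> simp [rotGen]

lemma det_rotGen : rotGen.det = 1 := by
  simp [rotGen, Matrix.det_fin_two]

lemma conj_rotGen (T : Matrix (Fin 2) (Fin 2) ℝ) : T * rotGen * Tᵀ = T.det • rotGen := by
  ext i j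
  fin_cases i <;> fin_cases j <;>
    simp [rotGen, Matrix.mul_apply, Fin.sum_univ_two, Matrix.det_fin_two] <;> ring

/-- The reflection in the orthogonal complement of the columns of `P` shows that `(Sᵀ y, Y)` is a
cut point as soon as `Y` rotates the plane spanned by these columns. -/
lemma mem_Cset_of_mul_eq_zero {k m : ℕ} (P : Matrix (Fin k) (Fin 2) ℝ)
    (S : Matrix (Fin m) (Fin k) ℝ) (hSP : S * P = 0) (hP : IsUnit (Pᵀ * P).det)
    (c : ℝ) (hc : c ≠ 0) (y : Fin m → ℝ) (Z : Matrix (Fin m) (Fin m) ℝ) (hZ : Zᵀ = -Z) :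
    (Sᵀ *ᵥ y, c • (P * rotGen * Pᵀ) + Sᵀ * Z * S) ∈ Cset k := by
  have hPS : Pᵀ * Sᵀ = 0 := by rw [← Matrix.transpose_mul, hSP, Matrix.transpose_zero]
  set G := Pᵀ * P with hG
  have hJ : IsUnit rotGen.det := by simp [det_rotGen]
  have hGt : Gᵀ = G := by simp [hG, Matrix.transpose_mul]
  have hGit : (G⁻¹)ᵀ = G⁻¹ := by rw [Matrix.transpose_nonsing_inv, hGt]
  set Y := c • (P * rotGen * Pᵀ) + Sᵀ * Z * S with hY
  have hPY : Pᵀ * Y = c • (G * rotGen * Pᵀ) := by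
    rw [hY, Matrix.mul_add, Matrix.mul_smul, ← Matrix.mul_assoc, ← Matrix.mul_assoc,
      ← Matrix.mul_assoc, ← Matrix.mul_assoc, hPS]
    simp [hG]
  have hcancel : ∀ {l : ℕ} (B : Matrix (Fin k) (Fin l) ℝ), Y * B = 0 → Pᵀ * B = 0 := by
    intro l B hB
    have h1 : G * (rotGen * (Pᵀ * B)) = 0 := by
      have : c • (G * rotGen * Pᵀ) * B = 0 := by
        rw [← hPY, Matrix.mul_assoc, hB, Matrix.mul_zero]
      rw [Matrix.smul_mul, smul_eq_zero] at this
      simpa [Matrix.mul_assoc] using this.resolve_left hc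
    have h2 := congrArg (fun X => rotGen⁻¹ * (G⁻¹ * X)) h1
    simpa [Matrix.nonsing_inv_mul_cancel_left _ _ hP,
      Matrix.nonsing_inv_mul_cancel_left _ _ hJ] using h2
  have hG0 : G ≠ 0 := by
    intro h
    rw [h] at hP
    simp at hP
  set M : Matrix (Fin k) (Fin k) ℝ := 1 - (2 : ℝ) • (P * G⁻¹ * Pᵀ) with hM
  have hMt : Mᵀ = M := by
    simp [hM, Matrix.transpose_mul, hGit, Matrix.mul_assoc]
  have hMP : M * P = -P := by
    rw [hM, Matrix.sub_mul, Matrix.smul_mul, Matrix.mul_assoc, ← hG, Matrix.mul_assoc,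
      Matrix.nonsing_inv_mul _ hP, Matrix.mul_one, Matrix.one_mul, two_smul]
    abel
  have hMS : M * Sᵀ = Sᵀ := by
    rw [hM, Matrix.sub_mul, Matrix.smul_mul, Matrix.mul_assoc, hPS]
    simp
  have hPM : Pᵀ * M = -Pᵀ := by
    have := congrArg Matrix.transpose hMP
    rwa [Matrix.transpose_mul, hMt, Matrix.transpose_neg] at this
  have hSM : S * M = S := by
    have := congrArg Matrix.transpose hMS
    rwa [Matrix.transpose_mul, hMt, Matrix.transpose_transpose] at this
  refine ⟨?_, ?_, M, ?_, ?_, ?_, ?_, ?_⟩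
  · simp only [hY, Matrix.transpose_add, Matrix.transpose_smul, Matrix.transpose_mul,
      Matrix.transpose_transpose, rotGen_transpose, hZ]
    simp [Matrix.mul_assoc, add_comm]
  · intro h
    apply hG0
    exact hcancel P (by rw [show Y = 0 from h, Matrix.zero_mul])
  · rw [hMt]
    nth_rw 2 [hM]
    rw [Matrix.mul_sub, Matrix.mul_smul, ← Matrix.mul_assoc, ← Matrix.mul_assoc, hMP, hM]
    simp
  · intro h
    rw [h, Matrix.one_mul] at hMP
    apply hG0
    have : P = 0 := by
      ext i j
      have := congrFun (congrFun hMP i) j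
      simp only [Matrix.neg_apply] at this
      simp only [Matrix.zero_apply]
      linarith
    simp [hG, this]
  · change M *ᵥ (Sᵀ *ᵥ y) = Sᵀ *ᵥ y
    rw [Matrix.mulVec_mulVec, hMS]
  · change M * Y * Mᵀ = Y
    rw [hMt, hY, Matrix.mul_add, Matrix.add_mul]
    congr 1
    · rw [Matrix.mul_smul, Matrix.smul_mul, ← Matrix.mul_assoc, ← Matrix.mul_assoc, hMP,
        Matrix.mul_assoc _ _ M, hPM]
      simp
    · rw [← Matrix.mul_assoc, ← Matrix.mul_assoc, hMS, Matrix.mul_assoc _ _ M, hSM]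
  · intro v hv
    have h := hcancel (l := 1) (Matrix.of fun i _ => v i) (by
      ext i j
      simpa [Matrix.mul_apply, Matrix.mulVec, dotProduct] using congrFun hv i)
    have h' : Pᵀ *ᵥ v = 0 := by
      ext i
      simpa [Matrix.mul_apply, Matrix.mulVec, dotProduct] using congrFun (congrFun h i) 0
    rw [hM, Matrix.sub_mulVec, Matrix.smul_mulVec, ← Matrix.mulVec_mulVec, h']
    simp

/-- A cut point admits a plane `span {u, w}` orthogonal to `x` which `Y` rotates. -/
lemma exists_rotated_plane {k : ℕ} {x : Fin k → ℝ} {Y : Matrix (Fin k) (Fin k) ℝ}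
    (h : (x, Y) ∈ Cset k) :
    ∃ (u w : Fin k → ℝ) (c : ℝ) (Y' : Matrix (Fin k) (Fin k) ℝ),
      u ≠ 0 ∧ w ≠ 0 ∧ u ⬝ᵥ w = 0 ∧ u ⬝ᵥ x = 0 ∧ w ⬝ᵥ x = 0 ∧ Y'ᵀ = -Y' ∧ Y' *ᵥ u = 0 ∧
      Y' *ᵥ w = 0 ∧ Y = c • (vecMulVec u w - vecMulVec w u) + Y' := by
  obtain ⟨hskew, -, M, hMM, hM1, hMx, hMY, hker⟩ := h
  dsimp only at hskew hMx hMY hker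
  have hMM' : Mᵀ * M = 1 := mul_eq_one_comm.mp hMM
  have hcomm : M * Y = Y * M := by
    calc M * Y = M * Y * (Mᵀ * M) := by rw [hMM', Matrix.mul_one]
      _ = Y * M := by rw [← Matrix.mul_assoc, hMY]
  have horth : ∀ z v : Fin k → ℝ, M *ᵥ v = v → ((1 - M) *ᵥ z) ⬝ᵥ v = 0 := by
    intro z v hv
    have h1 : Mᵀ *ᵥ v = v := by
      conv_lhs => rw [← hv]
      rw [Matrix.mulVec_mulVec, hMM', Matrix.one_mulVec]
    rw [dotProduct_comm, Matrix.dotProduct_mulVec, ← Matrix.mulVec_transpose]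
    simp [Matrix.sub_mulVec, h1]
  have hcomm' : ∀ z, Y *ᵥ ((1 - M) *ᵥ z) = (1 - M) *ᵥ (Y *ᵥ z) := by
    intro z
    simp only [Matrix.mulVec_mulVec, Matrix.mul_sub, Matrix.sub_mul, hcomm, Matrix.mul_one,
      Matrix.one_mul]
  have hherm : (Y * Y).IsHermitian := by
    simp [Matrix.IsHermitian, Matrix.conjTranspose_eq_transpose_of_trivial,
      hskew]
  obtain ⟨i, hi⟩ : ∃ i, (1 - M) *ᵥ (hherm.eigenvectorBasis i).ofLp ≠ 0 := by
    by_contra! hcon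
    apply hM1
    have : Matrix.toEuclideanLin (1 - M) = 0 := by
      refine hherm.eigenvectorBasis.toBasis.ext fun i => ?_
      rw [OrthonormalBasis.coe_toBasis, Matrix.toLpLin_apply, hcon i]
      simp
    have h2 : 1 - M = 0 := (Matrix.toEuclideanLin (𝕜 := ℝ)).map_eq_zero_iff.mp this
    exact (sub_eq_zero.mp h2).symm
  set z := (hherm.eigenvectorBasis i).ofLp with hz
  set μ := hherm.eigenvalues i
  set u := (1 - M) *ᵥ z with hu
  have hYz : Y *ᵥ (Y *ᵥ z) = μ • z := by
    rw [Matrix.mulVec_mulVec]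
    exact hherm.mulVec_eigenvectorBasis i
  have hYYu : Y *ᵥ (Y *ᵥ u) = μ • u := by
    rw [hu, hcomm', hcomm', hYz, Matrix.mulVec_smul]
  have hYu : Y *ᵥ u ≠ 0 := by
    intro h0
    have := horth z u (hker u h0)
    exact hi (dotProduct_self_eq_zero.mp this)
  have hadj : ∀ a b : Fin k → ℝ, a ⬝ᵥ (Y *ᵥ b) = -((Y *ᵥ a) ⬝ᵥ b) := by
    intro a b
    rw [Matrix.dotProduct_mulVec, ← Matrix.mulVec_transpose, hskew, Matrix.neg_mulVec,
      neg_dotProduct]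
  have huu : u ⬝ᵥ u ≠ 0 := fun h => hi (dotProduct_self_eq_zero.mp h)
  have huw : u ⬝ᵥ (Y *ᵥ u) = 0 := by
    have := hadj u u
    rw [dotProduct_comm (Y *ᵥ u)] at this
    linarith
  have hww : (Y *ᵥ u) ⬝ᵥ (Y *ᵥ u) = -μ * (u ⬝ᵥ u) := by
    rw [hadj, hYYu, smul_dotProduct, smul_eq_mul, neg_mul]
  refine ⟨u, Y *ᵥ u, -(u ⬝ᵥ u)⁻¹, Y - (-(u ⬝ᵥ u)⁻¹) • (vecMulVec u (Y *ᵥ u) -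
    vecMulVec (Y *ᵥ u) u), hi, hYu, huw, horth _ _ hMx, ?_, ?_, ?_, ?_, by abel⟩
  · rw [hu, hcomm']
    exact horth _ _ hMx
  · simp only [Matrix.transpose_sub, Matrix.transpose_smul, Matrix.transpose_vecMulVec, hskew]
    module
  · simp only [Matrix.sub_mulVec, Matrix.smul_mulVec, Matrix.vecMulVec_mulVec]
    rw [dotProduct_comm (Y *ᵥ u) u, huw]
    ext j
    simp
    field_simp
    ring
  · simp only [Matrix.sub_mulVec, Matrix.smul_mulVec, Matrix.vecMulVec_mulVec]
    rw [hww, huw, hYYu]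
    ext j
    simp
    field_simp
    ring

/-- The basis `[1; A]` of a plane which is a graph over the two coordinates `e (inl _)`. -/
def frame {k m : ℕ} (e : Fin 2 ⊕ Fin m ≃ Fin k) (A : Matrix (Fin m) (Fin 2) ℝ) :
    Matrix (Fin k) (Fin 2) ℝ :=
  (fromRows 1 A).submatrix e.symm id

/-- The matrix `[-A, 1]`, whose rows span the orthogonal complement of the columns of
`frame e A`. -/
def coframe {k m : ℕ} (e : Fin 2 ⊕ Fin m ≃ Fin k) (A : Matrix (Fin m) (Fin 2) ℝ) :
    Matrix (Fin m) (Fin k) ℝ :=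
  (fromCols (-A) 1).submatrix id e.symm

section Frame

variable {k m : ℕ} (e : Fin 2 ⊕ Fin m ≃ Fin k) (A : Matrix (Fin m) (Fin 2) ℝ)

@[simp] lemma frame_inl (i j : Fin 2) :
    frame e A (e (Sum.inl i)) j = (1 : Matrix (Fin 2) (Fin 2) ℝ) i j := by
  simp [frame]

@[simp] lemma frame_inr (i : Fin m) (j : Fin 2) : frame e A (e (Sum.inr i)) j = A i j := by
  simp [frame]

@[simp] lemma coframe_inl (i : Fin m) (j : Fin 2) : coframe e A i (e (Sum.inl j)) = -A i j := by
  simp [coframe]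

@[simp] lemma coframe_inr (i j : Fin m) :
    coframe e A i (e (Sum.inr j)) = (1 : Matrix (Fin m) (Fin m) ℝ) i j := by
  simp [coframe]

lemma coframe_mul_frame : coframe e A * frame e A = 0 := by
  rw [coframe, frame, Matrix.submatrix_mul_equiv, Matrix.fromCols_mul_fromRows]
  simp

lemma isUnit_det_frame : IsUnit ((frame e A)ᵀ * frame e A).det := by
  have h : (frame e A)ᵀ * frame e A = 1 + Aᴴ * A := by
    rw [frame, Matrix.transpose_submatrix, Matrix.submatrix_mul_equiv, Matrix.transpose_fromRows,
      Matrix.fromCols_mul_fromRows]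
    simp
  rw [h]
  exact (Matrix.isUnit_iff_isUnit_det _).mp
    (Matrix.PosDef.one.add_posSemidef (Matrix.posSemidef_conjTranspose_mul_self A)).isUnit

lemma frame_mul_add_mul_coframe :
    frame e A * (frame e 0)ᵀ + (coframe e 0)ᵀ * coframe e A = 1 := by
  ext i j
  obtain ⟨i, rfl⟩ := e.surjective i
  obtain ⟨j, rfl⟩ := e.surjective j
  rcases i with i | i <;> rcases j with j | j <;>
    simp [Matrix.mul_apply, Matrix.one_apply, eq_comm]

/-- A vector orthogonal to the columns of `frame e A` is a combination of the rows of
`coframe e A`. -/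
lemma eq_coframe_transpose_mulVec {x : Fin k → ℝ} (hx : (frame e A)ᵀ *ᵥ x = 0) :
    x = (coframe e A)ᵀ *ᵥ (coframe e 0 *ᵥ x) := by
  have h := congrArg (fun X => Xᵀ *ᵥ x) (frame_mul_add_mul_coframe e A)
  simp only [Matrix.transpose_add, Matrix.transpose_mul, Matrix.transpose_transpose,
    Matrix.add_mulVec, ← Matrix.mulVec_mulVec, hx, Matrix.mulVec_zero, zero_add,
    Matrix.transpose_one, Matrix.one_mulVec] at h
  exact h.symm

/-- A skew-symmetric matrix killing the columns of `frame e A` is a bilinear expression in the rows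
of `coframe e A`. -/
lemma eq_coframe_transpose_mul_mul {Y : Matrix (Fin k) (Fin k) ℝ} (hY : Yᵀ = -Y)
    (hA : Y * frame e A = 0) :
    Y = (coframe e A)ᵀ * (coframe e 0 * Y * (coframe e 0)ᵀ) * coframe e A := by
  have hA' : (frame e A)ᵀ * Y = 0 := by
    have := congrArg Matrix.transpose hA
    rw [Matrix.transpose_mul, hY, Matrix.mul_neg, Matrix.transpose_zero, neg_eq_zero] at this
    exact this
  have h := frame_mul_add_mul_coframe e A
  have h' := congrArg Matrix.transpose h
  simp only [Matrix.transpose_add, Matrix.transpose_mul, Matrix.transpose_transpose,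
    Matrix.transpose_one] at h'
  calc Y = 1 * Y * 1 := by simp
    _ = (frame e 0 * (frame e A)ᵀ + (coframe e A)ᵀ * coframe e 0) * Y *
        (frame e A * (frame e 0)ᵀ + (coframe e 0)ᵀ * coframe e A) := by rw [h, h']
    _ = ((coframe e A)ᵀ * coframe e 0) * Y *
        (frame e A * (frame e 0)ᵀ + (coframe e 0)ᵀ * coframe e A) := by
      rw [Matrix.add_mul, Matrix.mul_assoc (frame e 0), hA', Matrix.mul_zero, zero_add]
    _ = _ := by
      simp only [Matrix.mul_add, Matrix.mul_assoc]
      rw [← Matrix.mul_assoc Y (frame e A), hA]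
      simp

end Frame

/-- Indices of the entries of an `m × m` matrix strictly below the diagonal. -/
abbrev LowerIndex (m : ℕ) : Type := Σ i : Fin m, Fin i

/-- The skew-symmetric matrix with given entries below the diagonal. -/
def skewOfLower {m : ℕ} (t : LowerIndex m → ℝ) : Matrix (Fin m) (Fin m) ℝ := fun i j =>
  if h : j < i then t ⟨i, ⟨j, h⟩⟩ else if h : i < j then -t ⟨j, ⟨i, h⟩⟩ else 0

/-- The entries of a matrix below the diagonal. -/
def lowerPart {m : ℕ} (Z : Matrix (Fin m) (Fin m) ℝ) (s : LowerIndex m) : ℝ :=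
  Z s.1 ⟨s.2, s.2.2.trans s.1.2⟩

lemma skewOfLower_transpose {m : ℕ} (t : LowerIndex m → ℝ) :
    (skewOfLower t)ᵀ = -skewOfLower t := by
  ext i j
  simp only [Matrix.transpose_apply, Matrix.neg_apply, skewOfLower]
  rcases lt_trichotomy i j with h | rfl | h
  · simp [h, h.not_gt]
  · simp
  · simp [h, h.not_gt]

lemma skewOfLower_lowerPart {m : ℕ} {Z : Matrix (Fin m) (Fin m) ℝ} (hZ : Zᵀ = -Z) :
    skewOfLower (lowerPart Z) = Z := by
  ext i j
  have h1 : Z j i = -Z i j := congrFun (congrFun hZ i) j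
  simp only [skewOfLower, lowerPart]
  rcases lt_trichotomy i j with h | rfl | h
  · simp [h, h.not_gt, h1]
  · simp only [lt_self_iff_false, dite_false]
    linarith
  · simp [h]

@[simp] lemma lowerPart_skewOfLower {m : ℕ} (t : LowerIndex m → ℝ) :
    lowerPart (skewOfLower t) = t := by
  ext ⟨i, j, hj⟩
  have : (⟨j, hj.trans i.2⟩ : Fin m) < i := hj
  simp [lowerPart, skewOfLower, this]

@[simp] lemma skewOfLower_zero {m : ℕ} : skewOfLower (0 : LowerIndex m → ℝ) = 0 := by
  ext i j
  simp [skewOfLower]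

/-- The space of parameters `(A, c, y, t)` of a chart of the set of cut points. -/
abbrev Param (m : ℕ) : Type :=
  Matrix (Fin m) (Fin 2) ℝ × ℝ × (Fin m → ℝ) × (LowerIndex m → ℝ)

lemma finrank_param (m : ℕ) :
    Module.finrank ℝ (Param m) = (m + 2) * (m + 2 + 1) / 2 - 2 := by
  have h1 : Module.finrank ℝ (Param m) = m * 2 + (1 + (m + m * (m - 1) / 2)) := by
    have : Fintype.card (LowerIndex m) = m * (m - 1) / 2 := by
      rw [Fintype.card_sigma]
      simp [Fin.sum_univ_eq_sum_range (fun i => i), Finset.sum_range_id]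
    rw [Module.finrank_prod, Module.finrank_prod, Module.finrank_prod, Module.finrank_matrix,
      Module.finrank_fintype_fun_eq_card, Module.finrank_fintype_fun_eq_card, this]
    simp
  rw [h1]
  have h2 : (m + 2) * (m + 2 + 1) = m * (m - 1) + 2 * (3 * m + 3) := by
    cases m with
    | zero => rfl
    | succ n => simp only [Nat.add_sub_cancel]; ring
  rw [h2, Nat.add_mul_div_left _ _ (by norm_num)]
  omega

/-- The chart `(A, c, y, t) ↦ (Sᵀ y, c P J Pᵀ + Sᵀ Z S)` of the set of cut points. -/
def chart {k m : ℕ} (e : Fin 2 ⊕ Fin m ≃ Fin k) (θ : Param m) :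
    (Fin k → ℝ) × Matrix (Fin k) (Fin k) ℝ :=
  ((coframe e θ.1)ᵀ *ᵥ θ.2.2.1,
    θ.2.1 • (frame e θ.1 * rotGen * (frame e θ.1)ᵀ) +
      (coframe e θ.1)ᵀ * skewOfLower θ.2.2.2 * coframe e θ.1)

lemma chart_mem_Cset {k m : ℕ} (e : Fin 2 ⊕ Fin m ≃ Fin k) {θ : Param m} (hθ : θ.2.1 ≠ 0) :
    chart e θ ∈ Cset k :=
  mem_Cset_of_mul_eq_zero _ _ (coframe_mul_frame e _) (isUnit_det_frame e _) _ hθ _ _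
    (skewOfLower_transpose _)

lemma exists_equiv_apply_eq {m : ℕ} {i j : Fin (m + 2)} (hij : i ≠ j) :
    ∃ e : Fin 2 ⊕ Fin m ≃ Fin (m + 2), e (Sum.inl 0) = i ∧ e (Sum.inl 1) = j := by
  let e₀ : Fin 2 ⊕ Fin m ≃ Fin (m + 2) := finSumFinEquiv.trans (finCongr (Nat.add_comm 2 m))
  let e₁ := e₀.trans (Equiv.swap (e₀ (Sum.inl 0)) i)
  have h₁ : e₁ (Sum.inl 0) = i := by simp [e₁]
  refine ⟨e₁.trans (Equiv.swap (e₁ (Sum.inl 1)) j), ?_, by simp⟩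
  rw [Equiv.trans_apply, h₁]
  refine Equiv.swap_apply_of_ne_of_ne ?_ hij
  rw [← h₁]
  simp

lemma exists_minor_ne_zero {k : ℕ} {u w : Fin k → ℝ} (hu : u ≠ 0) (hw : w ≠ 0)
    (huw : u ⬝ᵥ w = 0) : ∃ i j, u i * w j - w i * u j ≠ 0 := by
  by_contra! h
  have huu : u ⬝ᵥ u ≠ 0 := fun h => hu (dotProduct_self_eq_zero.mp h)
  apply hw
  ext j
  have h1 : (u ⬝ᵥ u) * w j - (u ⬝ᵥ w) * u j = 0 := by
    simp only [dotProduct, Finset.sum_mul, ← Finset.sum_sub_distrib]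
    refine Finset.sum_eq_zero fun i _ => ?_
    have := h i j
    linear_combination u i * this
  rw [huw, zero_mul, sub_zero] at h1
  exact (mul_eq_zero.mp h1).resolve_left huu

lemma mem_range_chart {m : ℕ} {p : (Fin (m + 2) → ℝ) × Matrix (Fin (m + 2)) (Fin (m + 2)) ℝ}
    (hp : p ∈ Cset (m + 2)) :
    ∃ e : Fin 2 ⊕ Fin m ≃ Fin (m + 2), p ∈ Set.range (chart e) := by
  obtain ⟨x, Y⟩ := p
  obtain ⟨u, w, c, Y', hu, hw, huw, hux, hwx, hY't, hYu, hYw, rfl⟩ := exists_rotated_plane hp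
  obtain ⟨i, j, hd⟩ := exists_minor_ne_zero hu hw huw
  have hij : i ≠ j := by
    rintro rfl
    exact hd (by ring)
  obtain ⟨e, rfl, rfl⟩ := exists_equiv_apply_eq hij
  let U : Matrix (Fin (m + 2)) (Fin 2) ℝ := Matrix.of fun i => ![u i, w i]
  let T : Matrix (Fin 2) (Fin 2) ℝ := Matrix.of fun i => U (e (Sum.inl i))
  have hT : IsUnit T.det := by
    rw [isUnit_iff_ne_zero, Matrix.det_fin_two]
    simpa [T, U] using hd
  let A : Matrix (Fin m) (Fin 2) ℝ := Matrix.of fun i => (U * T⁻¹) (e (Sum.inr i))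
  have hP : frame e A = U * T⁻¹ := by
    ext l r
    obtain ⟨l, rfl⟩ := e.surjective l
    rcases l with l | l
    · rw [frame_inl, ← Matrix.mul_nonsing_inv _ hT]
      rfl
    · rw [frame_inr]
      rfl
  have hU : U = frame e A * T := by
    rw [hP, Matrix.mul_assoc, Matrix.nonsing_inv_mul _ hT, Matrix.mul_one]
  have hPx : (frame e A)ᵀ *ᵥ x = 0 := by
    have : Uᵀ *ᵥ x = 0 := by
      ext r
      fin_cases r
      · simpa [U, Matrix.mulVec, dotProduct] using hux
      · simpa [U, Matrix.mulVec, dotProduct] using hwx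
    rw [hP, Matrix.transpose_mul, ← Matrix.mulVec_mulVec, this, Matrix.mulVec_zero]
  have hYP : Y' * frame e A = 0 := by
    have : Y' * U = 0 := by
      ext l r
      fin_cases r
      · simpa [U, Matrix.mul_apply, Matrix.mulVec, dotProduct] using congrFun hYu l
      · simpa [U, Matrix.mul_apply, Matrix.mulVec, dotProduct] using congrFun hYw l
    rw [hP, ← Matrix.mul_assoc, this, Matrix.zero_mul]
  have hrot : vecMulVec u w - vecMulVec w u =
      T.det • (frame e A * rotGen * (frame e A)ᵀ) := by
    have h1 : vecMulVec u w - vecMulVec w u = U * rotGen * Uᵀ := by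
      ext a b
      simp [U, rotGen, Matrix.mul_apply, Fin.sum_univ_two, vecMulVec_apply]
      ring
    rw [h1, hU, Matrix.transpose_mul]
    calc frame e A * T * rotGen * (Tᵀ * (frame e A)ᵀ)
        = frame e A * (T * rotGen * Tᵀ) * (frame e A)ᵀ := by simp only [Matrix.mul_assoc]
      _ = _ := by rw [conj_rotGen]; simp
  have hZ : (coframe e 0 * Y' * (coframe e 0)ᵀ)ᵀ = -(coframe e 0 * Y' * (coframe e 0)ᵀ) := by
    simp [Matrix.transpose_mul, hY't, Matrix.mul_assoc]
  refine ⟨e, (A, c * T.det, coframe e 0 *ᵥ x,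
    lowerPart (coframe e 0 * Y' * (coframe e 0)ᵀ)), ?_⟩
  refine Prod.ext (eq_coframe_transpose_mulVec e A hPx).symm ?_
  simp only [chart]
  rw [skewOfLower_lowerPart hZ, ← eq_coframe_transpose_mul_mul e A hY't hYP, hrot, smul_smul]

lemma contDiff_skewOfLower {m : ℕ} (i j : Fin m) :
    ContDiff ℝ 1 fun t : LowerIndex m → ℝ => skewOfLower t i j := by
  unfold skewOfLower
  split_ifs <;> fun_prop

lemma contDiff_entry {m n : ℕ} (i : Fin m) (j : Fin n) :
    ContDiff ℝ 1 fun A : Matrix (Fin m) (Fin n) ℝ => A i j :=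
  contDiff_pi.mp (contDiff_pi.mp contDiff_id i) j

lemma contDiff_frame {k m : ℕ} (e : Fin 2 ⊕ Fin m ≃ Fin k) (i : Fin k) (j : Fin 2) :
    ContDiff ℝ 1 fun A : Matrix (Fin m) (Fin 2) ℝ => frame e A i j := by
  obtain ⟨i, rfl⟩ := e.surjective i
  rcases i with i | i
  · simp only [frame_inl]
    fun_prop
  · simp only [frame_inr]
    exact contDiff_entry i j

lemma contDiff_coframe {k m : ℕ} (e : Fin 2 ⊕ Fin m ≃ Fin k) (i : Fin m) (j : Fin k) :
    ContDiff ℝ 1 fun A : Matrix (Fin m) (Fin 2) ℝ => coframe e A i j := by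
  obtain ⟨j, rfl⟩ := e.surjective j
  rcases j with j | j
  · simp only [coframe_inl]
    exact (contDiff_entry i j).neg
  · simp only [coframe_inr]
    fun_prop

lemma contDiff_chart {k m : ℕ} (e : Fin 2 ⊕ Fin m ≃ Fin k) : ContDiff ℝ 1 (chart e) := by
  have hF : ∀ i j, ContDiff ℝ 1 fun θ : Param m => frame e θ.1 i j :=
    fun i j => (contDiff_frame e i j).comp contDiff_fst
  have hC : ∀ i j, ContDiff ℝ 1 fun θ : Param m => coframe e θ.1 i j :=
    fun i j => (contDiff_coframe e i j).comp contDiff_fst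
  have hS : ∀ i j, ContDiff ℝ 1 fun θ : Param m => skewOfLower θ.2.2.2 i j :=
    fun i j => (contDiff_skewOfLower i j).comp (by fun_prop)
  refine ContDiff.prodMk (contDiff_pi' fun i => ?_) (contDiff_pi' fun i => contDiff_pi' fun j => ?_)
  · simp only [Matrix.mulVec, dotProduct, Matrix.transpose_apply]
    fun_prop
  · simp only [Matrix.add_apply, Matrix.smul_apply, Matrix.mul_apply, Matrix.transpose_apply,
      smul_eq_mul]
    fun_prop

lemma dimH_Cset_le (m : ℕ) : dimH (Cset (m + 2)) ≤ Module.finrank ℝ (Param m) := by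
  calc dimH (Cset (m + 2))
      ≤ dimH (⋃ e : Fin 2 ⊕ Fin m ≃ Fin (m + 2), Set.range (chart e)) :=
        dimH_mono fun p hp => Set.mem_iUnion.mpr (mem_range_chart hp)
    _ ≤ Module.finrank ℝ (Param m) := by
        rw [dimH_iUnion]
        exact iSup_le fun e => (contDiff_chart e).dimH_range_le

/-- A linear map which is an approximate left inverse of `chart e` near `(0, 1, 0, 0)`. -/
def readParam {k m : ℕ} (e : Fin 2 ⊕ Fin m ≃ Fin k)
    (p : (Fin k → ℝ) × Matrix (Fin k) (Fin k) ℝ) : Param m :=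
  (fun l => ![p.2 (e (Sum.inr l)) (e (Sum.inl 1)), -p.2 (e (Sum.inr l)) (e (Sum.inl 0))],
    p.2 (e (Sum.inl 0)) (e (Sum.inl 1)),
    fun l => p.1 (e (Sum.inr l)),
    lowerPart (p.2.submatrix (e ∘ Sum.inr) (e ∘ Sum.inr)))

lemma contDiff_readParam {k m : ℕ} (e : Fin 2 ⊕ Fin m ≃ Fin k) :
    ContDiff ℝ 1 (readParam e) := by
  have hE : ∀ i j, ContDiff ℝ 1 fun p : (Fin k → ℝ) × Matrix (Fin k) (Fin k) ℝ => p.2 i j :=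
    fun i j => (contDiff_entry i j).comp contDiff_snd
  refine ContDiff.prodMk (contDiff_pi' fun l => contDiff_pi' fun r => ?_)
    ((hE _ _).prodMk (ContDiff.prodMk (by fun_prop) (contDiff_pi' fun s => hE _ _)))
  fin_cases r
  · exact hE _ _
  · exact (hE _ _).neg

lemma HasStrictFDerivAt.mul_of_eq_zero {E : Type*} [NormedAddCommGroup E] [NormedSpace ℝ E]
    {f g : E → ℝ} {x : E} (hf : ContDiff ℝ 1 f) (hg : ContDiff ℝ 1 g) (hf0 : f x = 0)
    (hg0 : g x = 0) : HasStrictFDerivAt (fun y => f y * g y) (0 : E →L[ℝ] ℝ) x := by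
  have := (hf.contDiffAt.hasStrictFDerivAt one_ne_zero (x := x)).mul
    (hg.contDiffAt.hasStrictFDerivAt one_ne_zero (x := x))
  rwa [hf0, hg0, zero_smul, zero_smul, add_zero] at this

lemma HasStrictFDerivAt.sum_mul_of_eq_zero {E ι : Type*} [NormedAddCommGroup E] [NormedSpace ℝ E]
    [Fintype ι] {f g : ι → E → ℝ} {x : E} (hf : ∀ i, ContDiff ℝ 1 (f i))
    (hg : ∀ i, ContDiff ℝ 1 (g i)) (hf0 : ∀ i, f i x = 0) (hg0 : ∀ i, g i x = 0) :
    HasStrictFDerivAt (fun y => ∑ i, f i y * g i y) (0 : E →L[ℝ] ℝ) x := by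
  have := HasStrictFDerivAt.fun_sum (u := Finset.univ)
    fun i _ => HasStrictFDerivAt.mul_of_eq_zero (hf i) (hg i) (hf0 i) (hg0 i)
  simpa using this

section ReadChart

variable {k m : ℕ} (e : Fin 2 ⊕ Fin m ≃ Fin k) (θ : Param m)

lemma readParam_chart_side (l : Fin m) (r : Fin 2) :
    (readParam e (chart e θ)).1 l r =
      θ.1 l r + ((θ.2.1 - 1) * θ.1 l r -
        ∑ j, skewOfLower θ.2.2.2 l j * ![θ.1 j 1, -θ.1 j 0] r) := by
  fin_cases r <;>
    simp [readParam, chart, rotGen, Matrix.mul_apply, Fin.sum_univ_two, Matrix.one_apply] <;>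
    ring

lemma readParam_chart_scale :
    (readParam e (chart e θ)).2.1 =
      θ.2.1 + ∑ i, (∑ l, θ.1 l 0 * skewOfLower θ.2.2.2 l i) * θ.1 i 1 := by
  simp [readParam, chart, rotGen, Matrix.mul_apply, Fin.sum_univ_two, Matrix.one_apply]

lemma readParam_chart_vector : (readParam e (chart e θ)).2.2.1 = θ.2.2.1 := by
  ext l
  simp [readParam, chart, Matrix.mulVec, dotProduct, Matrix.one_apply]

lemma readParam_chart_lower (s : LowerIndex m) :
    (readParam e (chart e θ)).2.2.2 s = θ.2.2.2 s +
      ∑ r, (θ.2.1 * ![-θ.1 s.1 1, θ.1 s.1 0] r) * θ.1 ⟨s.2, s.2.2.trans s.1.2⟩ r := by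
  conv_rhs => rw [← lowerPart_skewOfLower θ.2.2.2]
  simp [readParam, chart, lowerPart, rotGen, Matrix.mul_apply, Fin.sum_univ_two, Matrix.one_apply]
  ring

lemma hasStrictFDerivAt_readParam_chart :
    HasStrictFDerivAt (fun θ => readParam e (chart e θ)) (ContinuousLinearMap.id ℝ (Param m))
      (0, 1, 0, 0) := by
  have hA : ∀ i j, ContDiff ℝ 1 fun θ : Param m => θ.1 i j :=
    fun i j => (contDiff_entry i j).comp contDiff_fst
  have hS : ∀ i j, ContDiff ℝ 1 fun θ : Param m => skewOfLower θ.2.2.2 i j :=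
    fun i j => (contDiff_skewOfLower i j).comp (by fun_prop)
  have key : ∀ {f g : Param m → ℝ} (L : Param m →L[ℝ] ℝ),
      HasStrictFDerivAt g (0 : Param m →L[ℝ] ℝ) (0, 1, 0, 0) → (∀ θ, f θ = L θ + g θ) →
      HasStrictFDerivAt f L (0, 1, 0, 0) := by
    intro f g L hg hfg
    rw [funext hfg]
    exact (L.hasStrictFDerivAt.fun_add hg).congr_fderiv (add_zero L)
  have h1 : HasStrictFDerivAt (fun θ => (readParam e (chart e θ)).1)
      (ContinuousLinearMap.fst ℝ _ _) ((0, 1, 0, 0) : Param m) := by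
    refine hasStrictFDerivAt_pi'' fun l => hasStrictFDerivAt_pi'' fun r => ?_
    refine key _ ?_ fun θ => readParam_chart_side e θ l r
    rw [← sub_zero (0 : Param m →L[ℝ] ℝ)]
    refine (HasStrictFDerivAt.mul_of_eq_zero (by fun_prop) (hA l r) (by simp) (by simp)).fun_sub
      (HasStrictFDerivAt.sum_mul_of_eq_zero (fun j => hS l j) (fun j => ?_) (by simp) fun j => ?_)
    · fin_cases r
      · exact hA j 1
      · exact (hA j 0).neg
    · fin_cases r <;> simp
  have h2 : HasStrictFDerivAt (fun θ => (readParam e (chart e θ)).2.1)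
      ((ContinuousLinearMap.fst ℝ _ _).comp (ContinuousLinearMap.snd ℝ _ _))
      ((0, 1, 0, 0) : Param m) :=
    key _ (HasStrictFDerivAt.sum_mul_of_eq_zero (fun i => by fun_prop) (fun i => hA i 1)
      (by simp) (by simp)) (readParam_chart_scale e)
  have h3 : HasStrictFDerivAt (fun θ => (readParam e (chart e θ)).2.2.1)
      ((ContinuousLinearMap.fst ℝ _ _).comp
        ((ContinuousLinearMap.snd ℝ _ _).comp (ContinuousLinearMap.snd ℝ _ _)))
      ((0, 1, 0, 0) : Param m) := by
    rw [funext (readParam_chart_vector e)]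
    let L : Param m →L[ℝ] (Fin m → ℝ) := (ContinuousLinearMap.fst ℝ _ _).comp
      ((ContinuousLinearMap.snd ℝ _ _).comp (ContinuousLinearMap.snd ℝ _ _))
    exact L.hasStrictFDerivAt
  have h4 : HasStrictFDerivAt (fun θ => (readParam e (chart e θ)).2.2.2)
      ((ContinuousLinearMap.snd ℝ _ _).comp
        ((ContinuousLinearMap.snd ℝ _ _).comp (ContinuousLinearMap.snd ℝ _ _)))
      ((0, 1, 0, 0) : Param m) := by
    refine hasStrictFDerivAt_pi'' fun s => ?_
    refine key _ (HasStrictFDerivAt.sum_mul_of_eq_zero (fun r => ?_) (fun r => hA _ r)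
      (fun r => ?_) (by simp)) fun θ => readParam_chart_lower e θ s
    · refine ContDiff.mul (by fun_prop) ?_
      fin_cases r
      · exact (hA _ 1).neg
      · exact hA _ 0
    · fin_cases r <;> simp
  exact h1.prodMk (h2.prodMk (h3.prodMk h4))

end ReadChart

lemma le_dimH_Cset (m : ℕ) : (Module.finrank ℝ (Param m) : ℝ≥0∞) ≤ dimH (Cset (m + 2)) := by
  let e : Fin 2 ⊕ Fin m ≃ Fin (m + 2) := finSumFinEquiv.trans (finCongr (Nat.add_comm 2 m))
  have hmap := (hasStrictFDerivAt_readParam_chart e).map_nhds_eq_of_surj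
    (LinearMap.range_eq_top.mpr Function.surjective_id)
  have hU : {θ : Param m | θ.2.1 ≠ 0} ∈ nhds ((0, 1, 0, 0) : Param m) :=
    (isOpen_ne_fun (by fun_prop) (by fun_prop)).mem_nhds (by simp)
  have hV := hmap ▸ Filter.image_mem_map (m := fun θ => readParam e (chart e θ)) hU
  calc (Module.finrank ℝ (Param m) : ℝ≥0∞)
      = dimH ((fun θ => readParam e (chart e θ)) '' {θ : Param m | θ.2.1 ≠ 0}) :=
        (Real.dimH_of_mem_nhds hV).symm
    _ ≤ dimH (readParam e '' Cset (m + 2)) := by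
        refine dimH_mono ?_
        rintro _ ⟨θ, hθ, rfl⟩
        exact ⟨_, chart_mem_Cset e hθ, rfl⟩
    _ ≤ dimH (Cset (m + 2)) :=
        (contDiff_readParam e).contDiffOn.dimH_image_le convex_univ (Set.subset_univ _)

/-- `C_k` has Hausdorff dimension `k(k+1)/2 − 2`, i.e. codimension `2` in the
`k(k+1)/2`-dimensional group `𝔾_k ≅ ℝᵏ × Skew_k`. -/
theorem dimH_Cset (k : ℕ) (hk : 2 ≤ k) :
    dimH (Cset k) = ((k * (k + 1) / 2 - 2 : ℕ) : ℝ≥0∞) := by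
  obtain ⟨m, rfl⟩ := Nat.exists_eq_add_of_le' hk
  rw [← finrank_param]
  exact (dimH_Cset_le m).antisymm (le_dimH_Cset m)
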